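/- Stuttering property of branching team equivalence: in a finite-state machine, if m0[t1⟩m1[t2⟩...[tn⟩mn is a firing sequence in which every transition t_i is silent (l(t_i) = τ) and the sequence is sequential (•t_i = t_{i-1}• for i = 2, ..., n), and if m0 ≈^⊕ mn, then m_i ≈^⊕ m_j for all i, j = 0, ..., n. -/

import Mathlib

/- Common framework: finite-state machines (FSMs) in the sense of Gorrieri.
   Places form a type `S`, labels a type `A` with a distinguished silent label `tau`.
   A transition is a triple `(s, ℓ, m) : S × A × Option S`, where the post-set `m`
   is either a single place (`some s'`) or the empty marking θ (`none`).
   An FSM is given by a finite set `T` of such transitions. -/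

variable {S A : Type*}

/-- `Tr T s ℓ m` : place `s` has a transition labeled `ℓ` to post-set `m` (a place or θ). -/
def Tr (T : Finset (S × A × Option S)) (s : S) (ℓ : A) (m : Option S) : Prop :=
  (s, ℓ, m) ∈ T

/-- `SilentReach T tau s m` : `s ⇒ε m`, the reflexive–transitive closure of silent moves. -/
inductive SilentReach (T : Finset (S × A × Option S)) (tau : A) : S → Option S → Prop
  | refl (s : S) : SilentReach T tau s (some s)
  | step {s s' : S} {m : Option S} :
      SilentReach T tau s (some s') → Tr T s' tau m → SilentReach T tau s m

/-- Lift of a place relation to `Option S`; a pair involving θ (`none`) is related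
    only when both components are θ. -/
def OptRel (R : S → S → Prop) : Option S → Option S → Prop
  | some a, some b => R a b
  | none, none => True
  | _, _ => False

/-- `R` is a branching bisimulation on the FSM with transitions `T` and silent label `tau`. -/
def IsBranchingBisim (T : Finset (S × A × Option S)) (tau : A) (R : S → S → Prop) : Prop :=
  ∀ s1 s2, R s1 s2 →
    (∀ ℓ m1, Tr T s1 ℓ m1 →
        (ℓ = tau ∧ ∃ m2, SilentReach T tau s2 m2 ∧ OptRel R (some s1) m2 ∧ OptRel R m1 m2) ∨
        (∃ s m2, SilentReach T tau s2 (some s) ∧ Tr T s ℓ m2 ∧ R s1 s ∧ OptRel R m1 m2)) ∧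
    (∀ ℓ m2, Tr T s2 ℓ m2 →
        (ℓ = tau ∧ ∃ m1, SilentReach T tau s1 m1 ∧ OptRel R m1 (some s2) ∧ OptRel R m1 m2) ∨
        (∃ s m1, SilentReach T tau s1 (some s) ∧ Tr T s ℓ m1 ∧ R s s2 ∧ OptRel R m1 m2))

/-- Branching bisimilarity on places: `s ≈ s'` iff some branching bisimulation relates them. -/
def Bisimilar (T : Finset (S × A × Option S)) (tau : A) (s s' : S) : Prop :=
  ∃ R, IsBranchingBisim T tau R ∧ R s s'

/-- Rooted branching bisimilarity `≈_c` on places. -/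
def RootedBisimilar (T : Finset (S × A × Option S)) (tau : A) (s1 s2 : S) : Prop :=
  ∀ ℓ : A,
    (∀ m1, Tr T s1 ℓ m1 → ∃ m2, Tr T s2 ℓ m2 ∧ OptRel (Bisimilar T tau) m1 m2) ∧
    (∀ m2, Tr T s2 ℓ m2 → ∃ m1, Tr T s1 ℓ m1 ∧ OptRel (Bisimilar T tau) m1 m2)

/-- The post-set of a transition, as a marking (multiset). -/
def mpost (m : Option S) : Multiset S :=
  m.elim 0 (fun s => {s})

variable [DecidableEq S] [DecidableEq A]

/-- `Fires T m t m'` : transition `t` is enabled at marking `m` (`•t ∈ m`) and its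
    firing produces `m' = (m ⊖ •t) ⊕ t•`. -/
def Fires (T : Finset (S × A × Option S)) (m : Multiset S) (t : S × A × Option S)
    (m' : Multiset S) : Prop :=
  t ∈ T ∧ t.1 ∈ m ∧ m' = m.erase t.1 + mpost t.2.2

/-- `MStep T m ℓ m'` : marking `m` evolves to `m'` by firing some `ℓ`-labeled transition. -/
def MStep (T : Finset (S × A × Option S)) (m : Multiset S) (ℓ : A) (m' : Multiset S) : Prop :=
  ∃ t, Fires T m t m' ∧ t.2.1 = ℓ

/-- `Reach T m m'` : `m' ∈ reach(m)`, i.e. `m'` is reachable from `m` by a firing sequence. -/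
def Reach (T : Finset (S × A × Option S)) : Multiset S → Multiset S → Prop :=
  Relation.ReflTransGen (fun m m' => ∃ t, Fires T m t m')

/-- The additive closure `R^⊕` of a place relation `R`, relating markings. -/
inductive AddClosure (R : S → S → Prop) : Multiset S → Multiset S → Prop
  | zero : AddClosure R 0 0
  | cons {s1 s2 : S} {m1 m2 : Multiset S} :
      R s1 s2 → AddClosure R m1 m2 → AddClosure R (s1 ::ₘ m1) (s2 ::ₘ m2)

/-- The restricted net `N \ H`: all transitions with a label in `H` are pruned.
    (Places `s\H` of the restricted net are identified with the places `s` of `N`.) -/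
def restrictNet (T : Finset (S × A × Option S)) (H : Finset A) : Finset (S × A × Option S) :=
  T.filter (fun t => t.2.1 ∉ H)

/-- `DNI T tau H m0` : for all markings `m1, m2` reachable from `m0` and every `h ∈ H`
    with `m1 →h m2`, the restricted markings are branching team equivalent in `N \ H`. -/
def DNI (T : Finset (S × A × Option S)) (tau : A) (H : Finset A) (m0 : Multiset S) : Prop :=
  ∀ m1 m2, Reach T m0 m1 → Reach T m0 m2 →
    ∀ h ∈ H, MStep T m1 h m2 → AddClosure (Bisimilar (restrictNet T H) tau) m1 m2

/-- `FiresSeq T m σ m'` : the transition sequence `σ` can fire from `m` ending in `m'`. -/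
inductive FiresSeq (T : Finset (S × A × Option S)) : Multiset S → List (S × A × Option S) → Multiset S → Prop
  | nil (m : Multiset S) : FiresSeq T m [] m
  | cons {m m' m'' : Multiset S} {t : S × A × Option S} {σ : List (S × A × Option S)} :
      Fires T m t m' → FiresSeq T m' σ m'' → FiresSeq T m (t :: σ) m''

/-- One direction of the transfer property of branching bisimulations. -/
def IsBranchingSim {S A : Type*} (T : Finset (S × A × Option S)) (tau : A)
    (R : S → S → Prop) : Prop :=
  ∀ s1 s2, R s1 s2 → ∀ ℓ m1, Tr T s1 ℓ m1 →
    (ℓ = tau ∧ ∃ q, SilentReach T tau s2 (some q) ∧ R s1 q ∧ OptRel R m1 (some q)) ∨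
    (∃ s m2, SilentReach T tau s2 (some s) ∧ Tr T s ℓ m2 ∧ R s1 s ∧ OptRel R m1 m2)

section Places

variable {S A : Type*} {T : Finset (S × A × Option S)} {tau : A}

theorem OptRel.swap {R : S → S → Prop} {a b : Option S} :
    OptRel (fun x y => R y x) a b ↔ OptRel R b a := by
  cases a <;> cases b <;> rfl

theorem OptRel.imp {R R' : S → S → Prop} (h : ∀ x y, R x y → R' x y) {a b : Option S}
    (hab : OptRel R a b) : OptRel R' a b := by
  cases a <;> cases b <;> simp_all [OptRel]

theorem OptRel.comp {R R' : S → S → Prop} {a b c : Option S}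
    (hab : OptRel R a b) (hbc : OptRel R' b c) : OptRel (Relation.Comp R R') a c := by
  cases a <;> cases b <;> cases c <;> simp_all [OptRel]
  exact ⟨_, hab, hbc⟩

theorem OptRel.of_forall_self {R : S → S → Prop} (h : ∀ x, R x x) (a : Option S) :
    OptRel R a a := by
  cases a <;> simp_all [OptRel]

theorem SilentReach.trans {s s' : S} {m : Option S} (h : SilentReach T tau s (some s'))
    (h' : SilentReach T tau s' m) : SilentReach T tau s m := by
  induction h' with
  | refl => exact h
  | step _ ht ih => exact ih.step ht

theorem isBranchingBisim_iff {R : S → S → Prop} :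
    IsBranchingBisim T tau R ↔
      IsBranchingSim T tau R ∧ IsBranchingSim T tau (fun x y => R y x) := by
  constructor
  · intro h
    constructor
    · intro s1 s2 hs ℓ m1 ht
      rcases (h s1 s2 hs).1 ℓ m1 ht with ⟨hl, m2, hr, h1, h2⟩ | h'
      · cases m2 with
        | none => exact h1.elim
        | some q => exact Or.inl ⟨hl, q, hr, h1, h2⟩
      · exact Or.inr h'
    · intro s1 s2 hs ℓ m1 ht
      rcases (h s2 s1 hs).2 ℓ m1 ht with ⟨hl, m2, hr, h1, h2⟩ | ⟨s, m2, hr, hst, h1, h2⟩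
      · cases m2 with
        | none => exact h1.elim
        | some q => exact Or.inl ⟨hl, q, hr, h1, OptRel.swap.2 h2⟩
      · exact Or.inr ⟨s, m2, hr, hst, h1, OptRel.swap.2 h2⟩
  · rintro ⟨h1, h2⟩ s1 s2 hs
    constructor
    · intro ℓ m1 ht
      rcases h1 s1 s2 hs ℓ m1 ht with ⟨hl, q, hr, ha, hb⟩ | h'
      · exact Or.inl ⟨hl, some q, hr, ha, hb⟩
      · exact Or.inr h'
    · intro ℓ m1 ht
      rcases h2 s2 s1 hs ℓ m1 ht with ⟨hl, q, hr, ha, hb⟩ | ⟨s, m2, hr, hst, ha, hb⟩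
      · exact Or.inl ⟨hl, some q, hr, ha, OptRel.swap.1 hb⟩
      · exact Or.inr ⟨s, m2, hr, hst, ha, OptRel.swap.1 hb⟩

theorem IsBranchingSim.silentReach {R : S → S → Prop} (hR : IsBranchingSim T tau R)
    {p q : S} {m : Option S} (hp : SilentReach T tau p m) (hpq : R p q) :
    ∃ m', SilentReach T tau q m' ∧ OptRel R m m' := by
  induction hp with
  | refl => exact ⟨some q, .refl q, hpq⟩
  | step _ ht ih =>
    obtain ⟨m', hq, hm⟩ := ih
    cases m' with
    | none => exact hm.elim
    | some q' =>
      rcases hR _ _ hm _ _ ht with ⟨-, q'', hr, -, h⟩ | ⟨s, m2, hr, hst, -, h⟩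
      · exact ⟨some q'', hq.trans hr, h⟩
      · exact ⟨m2, (hq.trans hr).step hst, h⟩

theorem IsBranchingSim.comp {R R' : S → S → Prop} (hR : IsBranchingSim T tau R)
    (hR' : IsBranchingSim T tau R') : IsBranchingSim T tau (Relation.Comp R R') := by
  rintro s1 s3 ⟨s2, h12, h23⟩ ℓ m1 ht
  have reach : ∀ {x}, SilentReach T tau s2 (some x) →
      ∃ y, SilentReach T tau s3 (some y) ∧ R' x y := by
    intro x hx
    obtain ⟨m', hm, h⟩ := hR'.silentReach hx h23
    cases m' with
    | none => exact h.elim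
    | some y => exact ⟨y, hm, h⟩
  rcases hR _ _ h12 _ _ ht with ⟨hl, x, hx, h1, h2⟩ | ⟨x, m2, hx, hxm, h1, h2⟩
  · obtain ⟨y, hy, hxy⟩ := reach hx
    exact Or.inl ⟨hl, y, hy, ⟨x, h1, hxy⟩, OptRel.comp (b := some x) h2 hxy⟩
  · obtain ⟨y, hy, hxy⟩ := reach hx
    rcases hR' _ _ hxy _ _ hxm with ⟨hl, z, hz, h3, h4⟩ | ⟨z, m3, hz, hzm, h3, h4⟩
    · exact Or.inl ⟨hl, z, hy.trans hz, ⟨x, h1, h3⟩, h2.comp h4⟩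
    · exact Or.inr ⟨z, m3, hy.trans hz, hzm, ⟨x, h1, h3⟩, h2.comp h4⟩

theorem Bisimilar.refl (s : S) : Bisimilar T tau s s := by
  refine ⟨Eq, isBranchingBisim_iff.2 ⟨?_, ?_⟩, rfl⟩
  · rintro s _ rfl ℓ m ht
    exact Or.inr ⟨s, m, .refl s, ht, rfl, .of_forall_self (fun _ => rfl) m⟩
  · rintro s _ rfl ℓ m ht
    exact Or.inr ⟨_, m, .refl _, ht, rfl, OptRel.swap.2 (.of_forall_self (fun _ => rfl) m)⟩

theorem Bisimilar.symm {s s' : S} (h : Bisimilar T tau s s') : Bisimilar T tau s' s := by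
  obtain ⟨R, hR, hs⟩ := h
  exact ⟨fun x y => R y x, isBranchingBisim_iff.2 (isBranchingBisim_iff.1 hR).symm, hs⟩

theorem Bisimilar.trans {s s' s'' : S} (h : Bisimilar T tau s s')
    (h' : Bisimilar T tau s' s'') : Bisimilar T tau s s'' := by
  obtain ⟨R, hR, hs⟩ := h
  obtain ⟨R', hR', hs'⟩ := h'
  rw [isBranchingBisim_iff] at hR hR'
  refine ⟨Relation.Comp R R', isBranchingBisim_iff.2 ⟨hR.1.comp hR'.1, ?_⟩, s', hs, hs'⟩
  have hswap : (fun x y => Relation.Comp R R' y x) =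
      Relation.Comp (fun x y => R' y x) (fun x y => R y x) := by
    funext x y
    exact propext (exists_congr fun _ => and_comm)
  rw [hswap]
  exact hR'.2.comp hR.2

theorem bisimilar_equivalence : Equivalence (Bisimilar T tau) :=
  ⟨.refl, .symm, .trans⟩

theorem isBranchingSim_bisimilar : IsBranchingSim T tau (Bisimilar T tau) := by
  rintro s1 s2 ⟨R, hR, hs⟩ ℓ m1 ht
  have himp : ∀ x y, R x y → Bisimilar T tau x y := fun x y h => ⟨R, hR, h⟩
  rcases (isBranchingBisim_iff.1 hR).1 _ _ hs _ _ ht with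
    ⟨hl, q, hr, h1, h2⟩ | ⟨s, m2, hr, hst, h1, h2⟩
  · exact Or.inl ⟨hl, q, hr, himp _ _ h1, h2.imp himp⟩
  · exact Or.inr ⟨s, m2, hr, hst, himp _ _ h1, h2.imp himp⟩

/-- Stuttering property for places. -/
theorem Bisimilar.of_silentReach {p q r : S} (hpq : SilentReach T tau p (some q))
    (hqr : SilentReach T tau q (some r)) (h : Bisimilar T tau p r) : Bisimilar T tau p q := by
  let R : S → S → Prop := fun x y =>
    Bisimilar T tau x y ∨ (x = p ∧ y = q) ∨ (x = q ∧ y = p)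
  have himp : ∀ x y, Bisimilar T tau x y → R x y := fun _ _ => Or.inl
  have hsymm : (fun x y => R y x) = R := by
    funext x y
    have : Bisimilar T tau y x ↔ Bisimilar T tau x y := ⟨.symm, .symm⟩
    simp only [R, this, eq_iff_iff]
    tauto
  have hsim : IsBranchingSim T tau R := by
    rintro s1 s2 (hs | ⟨rfl, rfl⟩ | ⟨rfl, rfl⟩) ℓ m1 ht
    · rcases isBranchingSim_bisimilar _ _ hs _ _ ht with
        ⟨hl, x, hr, h1, h2⟩ | ⟨s, m2, hr, hst, h1, h2⟩
      · exact Or.inl ⟨hl, x, hr, Or.inl h1, h2.imp himp⟩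
      · exact Or.inr ⟨s, m2, hr, hst, Or.inl h1, h2.imp himp⟩
    · rcases isBranchingSim_bisimilar _ _ h _ _ ht with
        ⟨hl, x, hr, h1, h2⟩ | ⟨s, m2, hr, hst, h1, h2⟩
      · exact Or.inl ⟨hl, x, hqr.trans hr, Or.inl h1, h2.imp himp⟩
      · exact Or.inr ⟨s, m2, hqr.trans hr, hst, Or.inl h1, h2.imp himp⟩
    · exact Or.inr ⟨_, m1, hpq, ht, Or.inl (.refl _),
        (OptRel.of_forall_self Bisimilar.refl m1).imp himp⟩
  exact ⟨R, isBranchingBisim_iff.2 ⟨hsim, hsymm ▸ hsim⟩, Or.inr (Or.inl ⟨rfl, rfl⟩)⟩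

theorem SilentReach.of_chain {p : ℕ → S} {i j : ℕ} (hij : i ≤ j)
    (hp : ∀ k, i ≤ k → k < j → Tr T (p k) tau (some (p (k + 1)))) :
    SilentReach T tau (p i) (some (p j)) := by
  induction j, hij using Nat.le_induction with
  | base => exact .refl _
  | succ j hij ih =>
    exact (ih fun k h1 h2 => hp k h1 (by omega)).step (hp j hij (by omega))

end Places

section Markings

variable {S : Type*} {R : S → S → Prop}

theorem AddClosure.of_forall_self (h : ∀ s, R s s) (m : Multiset S) : AddClosure R m m := by
  induction m using Multiset.induction with
  | empty => exact .zero
  | cons s m ih => exact .cons (h s) ih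

theorem AddClosure.card_eq {m1 m2 : Multiset S} (h : AddClosure R m1 m2) :
    m1.card = m2.card := by
  induction h with
  | zero => rfl
  | cons _ _ ih => simp [ih]

theorem AddClosure.map_mk_eq {r : Setoid S} {m1 m2 : Multiset S}
    (h : AddClosure r m1 m2) :
    m1.map (Quotient.mk r) = m2.map (Quotient.mk r) := by
  induction h with
  | zero => rfl
  | cons hs _ ih => simp only [Multiset.map_cons, ih, Quotient.sound hs]

theorem AddClosure.cons_cancel (hR : Equivalence R) {s s' : S} {k : Multiset S}
    (h : AddClosure R (s ::ₘ k) (s' ::ₘ k)) : R s s' := by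
  let r : Setoid S := ⟨R, hR⟩
  have h' := AddClosure.map_mk_eq (r := r) h
  simp only [Multiset.map_cons, Multiset.cons_inj_left] at h'
  exact Quotient.exact h'

end Markings

/-- Stuttering property of branching team equivalence: for a silent,
    sequential firing sequence `ms 0 [ts 1⟩ ms 1 ... [ts n⟩ ms n`, if
    `ms 0 ≈^⊕ ms n`, then `ms i ≈^⊕ ms j` for all `i, j`. -/
theorem team_stuttering_property [Fintype S] [Fintype A] [DecidableEq S] [DecidableEq A]
    (T : Finset (S × A × Option S)) (tau : A) (n : ℕ)
    (ms : Fin (n + 1) → Multiset S) (ts : Fin n → S × A × Option S)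
    (hfire : ∀ i : Fin n, Fires T (ms i.castSucc) (ts i) (ms i.succ))
    (hsilent : ∀ i : Fin n, (ts i).2.1 = tau)
    (hseq : ∀ (i : Fin n) (h : (i : ℕ) + 1 < n), (ts i).2.2 = some ((ts ⟨i + 1, h⟩).1))
    (hbis : AddClosure (Bisimilar T tau) (ms 0) (ms (Fin.last n))) :
    ∀ i j : Fin (n + 1), AddClosure (Bisimilar T tau) (ms i) (ms j) := by
  obtain _ | n := n
  · intro i j
    rw [Subsingleton.elim (α := Fin 1) i j]
    exact .of_forall_self .refl _
  -- the context `k` left untouched by every firing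
  obtain ⟨k, hk⟩ := Multiset.exists_cons_of_mem (hfire 0).2.1
  have hpre : ∀ (i : ℕ) (h : i < n + 1),
      ms (Fin.castSucc ⟨i, h⟩) = (ts ⟨i, h⟩).1 ::ₘ k := by
    intro i
    induction i with
    | zero => exact fun _ => hk
    | succ i ih =>
      intro h
      have hi : i < n + 1 := by omega
      have hf := (hfire ⟨i, hi⟩).2.2
      rw [ih hi, Multiset.erase_cons_head, hseq ⟨i, hi⟩ h] at hf
      rw [← Multiset.singleton_add, add_comm _ k]
      exact hf
  have hlast : ms (Fin.last (n + 1)) = k + mpost (ts (Fin.last n)).2.2 := by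
    have hf := (hfire (Fin.last n)).2.2
    have hp := hpre n n.lt_succ_self
    rw [show (⟨n, n.lt_succ_self⟩ : Fin (n + 1)) = Fin.last n from rfl] at hp
    rwa [hp, Multiset.erase_cons_head] at hf
  obtain ⟨r, hr⟩ : ∃ r, (ts (Fin.last n)).2.2 = some r := by
    rw [← Option.ne_none_iff_exists']
    intro h
    have hc := hbis.card_eq
    have h0 := hpre 0 n.succ_pos
    rw [show Fin.castSucc (⟨0, n.succ_pos⟩ : Fin (n + 1)) = 0 from rfl] at h0
    rw [hlast, h, h0] at hc
    simp [mpost] at hc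
  let p : ℕ → S := fun i => if h : i < n + 1 then (ts ⟨i, h⟩).1 else r
  have hms : ∀ i : Fin (n + 2), ms i = p i ::ₘ k := by
    intro i
    induction i using Fin.lastCases with
    | last =>
      rw [hlast, hr, add_comm]
      simp [p, mpost]
    | cast i =>
      rw [hpre i i.2]
      simp only [p, Fin.val_castSucc, dif_pos i.2]
  have hstep : ∀ i, i < n + 1 → Tr T (p i) tau (some (p (i + 1))) := by
    intro i hi
    have hpost : (ts ⟨i, hi⟩).2.2 = some (p (i + 1)) := by
      by_cases h : i + 1 < n + 1
      · rw [hseq ⟨i, hi⟩ h]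
        simp only [p, dif_pos h]
      · obtain rfl : n = i := by omega
        simp only [p, dif_neg h]
        exact hr
    have hT := (hfire ⟨i, hi⟩).1
    simp only [Tr, p, dif_pos hi]
    rwa [← hsilent ⟨i, hi⟩, ← hpost]
  have hends : Bisimilar T tau (p 0) (p (n + 1)) := by
    rw [hms 0, hms (Fin.last (n + 1))] at hbis
    exact hbis.cons_cancel bisimilar_equivalence
  have hstart : ∀ i : Fin (n + 2), Bisimilar T tau (p 0) (p i) := fun i =>
    hends.of_silentReach
      (.of_chain i.1.zero_le fun j _ hj => hstep j (by omega))
      (.of_chain (Nat.le_of_lt_succ i.2) fun j _ hj => hstep j hj)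
  intro i j
  rw [hms i, hms j]
  exact .cons ((hstart i).symm.trans (hstart j)) (.of_forall_self .refl k)
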